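/- arXiv:2602.14480 — 4 statements merged into one kernel-verified Lean document; each statement's English description precedes it below -/
import Mathlib

section
/- Let v, h ∈ ℝ^d and let (λ_n)_{n≥1} be a sequence of nonnegative real numbers with λ_n/√n → λ₀ ≥ 0 as n → ∞. Then λ_n · (‖v + h/√n‖₁ − ‖v‖₁) → λ₀ · φ_{1,v}(h) as n → ∞. -/
/-- sign function: 1 for positive, -1 for negative, 0 at 0. -/
noncomputable def sgn (u : ℝ) : ℝ := if 0 < u then 1 else if u < 0 then -1 else 0

/-- φ_{1,v}(h) = Σ_{k : v_k ≠ 0} sgn(v_k) h_k + Σ_{k : v_k = 0} |h_k|. -/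
noncomputable def phi1 {d : ℕ} (v h : Fin d → ℝ) : ℝ :=
  (∑ k ∈ Finset.univ.filter (fun k => v k ≠ 0), sgn (v k) * h k)
    + ∑ k ∈ Finset.univ.filter (fun k => v k = 0), |h k|

/-- The increment of the absolute value is eventually linear along a direction. -/
lemma abs_add_div_sub_abs_eventually {ι : Type*} {l : Filter ι} {r : ι → ℝ}
    (hr : Filter.Tendsto r l Filter.atTop) (a b : ℝ) :
    ∀ᶠ i in l, |a + b / r i| - |a| = (if a ≠ 0 then sgn a * b else |b|) / r i := by
  have hlim : Filter.Tendsto (fun i => a + b / r i) l (nhds a) := by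
    simpa using (hr.const_div_atTop b).const_add a
  rcases lt_trichotomy a 0 with ha | rfl | ha
  · filter_upwards [hlim.eventually_lt_const ha] with i hi
    rw [abs_of_neg hi, abs_of_neg ha, if_pos ha.ne, sgn, if_neg ha.not_gt, if_pos ha]
    ring
  · filter_upwards [hr.eventually_gt_atTop 0] with i hi
    simp [abs_div, abs_of_pos hi]
  · filter_upwards [hlim.eventually_const_lt ha] with i hi
    rw [abs_of_pos hi, abs_of_pos ha, if_pos ha.ne', sgn, if_pos ha]
    ring

/-- `phi1` as a single sum over the coordinates. -/
lemma phi1_eq_sum_ite {d : ℕ} (v h : Fin d → ℝ) :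
    phi1 v h = ∑ k, if v k ≠ 0 then sgn (v k) * h k else |h k| := by
  rw [Finset.sum_ite, phi1]
  simp only [ne_eq, not_not]

/-- If λ_n ≥ 0 and λ_n/√n → λ₀ ≥ 0, then
λ_n (‖v + h/√n‖₁ − ‖v‖₁) → λ₀ φ_{1,v}(h). -/
theorem l1_penalty_limit {d : ℕ} (v h : Fin d → ℝ)
    (lam : ℕ → ℝ) (hlam : ∀ n, 0 ≤ lam n) (lam0 : ℝ) (hlam0 : 0 ≤ lam0)
    (hconv : Filter.Tendsto (fun n : ℕ => lam n / Real.sqrt n) Filter.atTop (nhds lam0)) :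
    Filter.Tendsto
      (fun n : ℕ => lam n * ((∑ k, |v k + h k / Real.sqrt n|) - ∑ k, |v k|))
      Filter.atTop (nhds (lam0 * phi1 v h)) := by
  have hsqrt : Filter.Tendsto (fun n : ℕ => Real.sqrt n) Filter.atTop Filter.atTop :=
    Real.tendsto_sqrt_atTop.comp tendsto_natCast_atTop_atTop
  refine (hconv.mul_const (phi1 v h)).congr' ?_
  filter_upwards [Filter.eventually_all.2 fun k =>
    abs_add_div_sub_abs_eventually hsqrt (v k) (h k)] with n hn
  rw [← Finset.sum_sub_distrib, Finset.sum_congr rfl fun k _ => hn k, ← Finset.sum_div,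
    ← phi1_eq_sum_ite]
  ring
end

section
/- Let Σ_t ∈ ℝ^{t×t} and Σ_s ∈ ℝ^{s×s} be symmetric matrices with nonnegative diagonal entries, let Σ := Σ_s ⊗ I_t + I_s ⊗ Σ_t ∈ ℝ^{ts×ts} (indexed by pairs (i,j) ↦ i + (j−1)t), and let θ ∈ ℝ^{t×s}. Then the GTV penalty decouples additively into temporal and spatial components: Σ_{(i,j),(i',j')} |Σ_{(i,j),(i',j')}|^{1/2} · |θ_{ij} − sgn(Σ_{(i,j),(i',j')}) θ_{i'j'}| = Σ_{i,i'=1}^{t} |(Σ_t)_{ii'}|^{1/2} ‖θ_{i·} − sgn((Σ_t)_{ii'}) θ_{i'·}‖₁ + Σ_{j,j'=1}^{s} |(Σ_s)_{jj'}|^{1/2} ‖θ_{·j} − sgn((Σ_s)_{jj'}) θ_{·j'}‖₁, where the left-hand sum ranges over all ordered pairs ((i,j),(i',j')) ∈ ({1,…,t}×{1,…,s})². -/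
open Kronecker

/-- The Kronecker sum Σ = Σ_s ⊗ I_t + I_s ⊗ Σ_t, indexed by pairs (spatial, temporal). -/
noncomputable def kronSum (t s : ℕ)
    (St : Matrix (Fin t) (Fin t) ℝ) (Ss : Matrix (Fin s) (Fin s) ℝ) :
    Matrix (Fin s × Fin t) (Fin s × Fin t) ℝ :=
  Ss ⊗ₖ (1 : Matrix (Fin t) (Fin t) ℝ) + (1 : Matrix (Fin s) (Fin s) ℝ) ⊗ₖ St

/-- An edge with nonnegative weight joining a point to itself contributes no penalty. -/
theorem sqrt_abs_mul_abs_sub_sgn_mul_self {a : ℝ} (ha : 0 ≤ a) (x : ℝ) :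
    Real.sqrt |a| * |x - sgn a * x| = 0 := by
  rcases ha.eq_or_lt with rfl | h
  · simp
  · simp [sgn, h]

theorem kronSum_penalty_entry {t s : ℕ}
    {St : Matrix (Fin t) (Fin t) ℝ} {Ss : Matrix (Fin s) (Fin s) ℝ}
    (hSt : ∀ i, 0 ≤ St i i) (hSs : ∀ j, 0 ≤ Ss j j)
    (θ : Matrix (Fin t) (Fin s) ℝ) (i i' : Fin t) (j j' : Fin s) :
    Real.sqrt |kronSum t s St Ss (j, i) (j', i')|
        * |θ i j - sgn (kronSum t s St Ss (j, i) (j', i')) * θ i' j'|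
      = (if j = j' then Real.sqrt |St i i'| * |θ i j - sgn (St i i') * θ i' j'| else 0)
        + (if i = i' then Real.sqrt |Ss j j'| * |θ i j - sgn (Ss j j') * θ i' j'| else 0) := by
  have hk : kronSum t s St Ss (j, i) (j', i')
      = (if i = i' then Ss j j' else 0) + (if j = j' then St i i' else 0) := by
    simp [kronSum, Matrix.one_apply]
  rw [hk]
  by_cases hi : i = i' <;> by_cases hj : j = j'
  · subst hi hj
    simp [sqrt_abs_mul_abs_sub_sgn_mul_self, hSt, hSs, add_nonneg, -mul_eq_zero]
  all_goals simp [hi, hj]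

/-- Under a Kronecker-sum covariance Σ = Σ_s ⊕ Σ_t (with symmetric Σ_t, Σ_s having
nonnegative diagonals), the GTV penalty decouples additively into temporal and
spatial components. -/
theorem gtv_penalty_decoupling (t s : ℕ)
    (St : Matrix (Fin t) (Fin t) ℝ) (Ss : Matrix (Fin s) (Fin s) ℝ)
    (hStsymm : St.IsSymm) (hSssymm : Ss.IsSymm)
    (hStdiag : ∀ i, 0 ≤ St i i) (hSsdiag : ∀ j, 0 ≤ Ss j j)
    (θ : Matrix (Fin t) (Fin s) ℝ) :
    (∑ i : Fin t, ∑ j : Fin s, ∑ i' : Fin t, ∑ j' : Fin s,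
        Real.sqrt |kronSum t s St Ss (j, i) (j', i')|
          * |θ i j - sgn (kronSum t s St Ss (j, i) (j', i')) * θ i' j'|)
      = (∑ i : Fin t, ∑ i' : Fin t,
          Real.sqrt |St i i'| * (∑ j : Fin s, |θ i j - sgn (St i i') * θ i' j|))
        + ∑ j : Fin s, ∑ j' : Fin s,
            Real.sqrt |Ss j j'| * (∑ i : Fin t, |θ i j - sgn (Ss j j') * θ i j'|) := by
  simp only [kronSum_penalty_entry hStdiag hSsdiag, Finset.sum_add_distrib, Finset.mul_sum]
  congr 1
  · refine Finset.sum_congr rfl fun i _ => ?_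
    rw [Finset.sum_comm]
    simp
  · rw [Finset.sum_comm]
    refine Finset.sum_congr rfl fun j _ => ?_
    rw [Finset.sum_comm (s := Finset.univ (α := Fin s))]
    refine Finset.sum_congr rfl fun i _ => ?_
    rw [Finset.sum_comm]
    simp
end

section
/- Let u ∈ ℝ^m and λ₁, λ₂ ≥ 0. Define v ∈ ℝ^m componentwise by v_k = sgn(u_k) · max(|u_k| − λ₁, 0) (soft thresholding), and define w := (1 − λ₂/‖v‖₂) · v if ‖v‖₂ > λ₂, and w := 0 otherwise. Then w is the unique global minimizer over x ∈ ℝ^m of the function x ↦ λ₁‖x‖₁ + λ₂‖x‖₂ + (1/2)‖x − u‖₂². In other words, the proximal mapping of the sparse group lasso penalty λ₁‖·‖₁ + λ₂‖·‖₂ is the composition of the proximal mapping of λ₂‖·‖₂ with the proximal mapping of λ₁‖·‖₁. -/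
/-- Componentwise soft thresholding v_k = sgn(u_k) · max(|u_k| − λ₁, 0). -/
noncomputable def softThresh {m : ℕ} (lam1 : ℝ) (u : Fin m → ℝ) : Fin m → ℝ :=
  fun k => sgn (u k) * max (|u k| - lam1) 0

open Classical in
/-- Group shrinkage applied to the soft-thresholded vector v:
w = (1 − λ₂/‖v‖₂) v if ‖v‖₂ > λ₂, and w = 0 otherwise. -/
noncomputable def sglProx {m : ℕ} (lam1 lam2 : ℝ) (u : Fin m → ℝ) : Fin m → ℝ :=
  if lam2 < Real.sqrt (∑ k, (softThresh lam1 u k) ^ 2) then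
    fun k => (1 - lam2 / Real.sqrt (∑ j, (softThresh lam1 u j) ^ 2)) * softThresh lam1 u k
  else 0

theorem abs_sub_softThresh_le {m : ℕ} {lam1 : ℝ} (hlam1 : 0 ≤ lam1) (u : Fin m → ℝ) (k : Fin m) :
    |u k - softThresh lam1 u k| ≤ lam1 := by
  unfold softThresh sgn
  rcases lt_trichotomy (u k) 0 with h | h | h
  · rw [if_neg h.not_gt, if_pos h, abs_of_neg h, abs_le]
    rcases max_cases (-u k - lam1) 0 with ⟨e, _⟩ | ⟨e, _⟩ <;> rw [e] <;> constructor <;> linarith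
  · simpa [h] using hlam1
  · rw [if_pos h, abs_of_pos h, abs_le]
    rcases max_cases (u k - lam1) 0 with ⟨e, _⟩ | ⟨e, _⟩ <;> rw [e] <;> constructor <;> linarith

theorem sub_softThresh_mul_softThresh {m : ℕ} (lam1 : ℝ) (u : Fin m → ℝ) (k : Fin m) :
    (u k - softThresh lam1 u k) * softThresh lam1 u k = lam1 * |softThresh lam1 u k| := by
  unfold softThresh sgn
  rcases lt_trichotomy (u k) 0 with h | h | h
  · rw [if_neg h.not_gt, if_pos h, abs_of_neg h]
    rcases max_cases (-u k - lam1) 0 with ⟨e, he⟩ | ⟨e, _⟩ <;> rw [e]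
    · rw [neg_one_mul, abs_neg, abs_of_nonneg he]; ring
    · simp
  · simp [h]
  · rw [if_pos h, abs_of_pos h]
    rcases max_cases (u k - lam1) 0 with ⟨e, he⟩ | ⟨e, _⟩ <;> rw [e]
    · rw [one_mul, abs_of_nonneg he]; ring
    · simp

/-- The group shrinkage is a nonnegative multiple of the soft-thresholded vector, and the residual
is a subgradient of `λ₂‖·‖₂` at it. -/
theorem sglProx_spec {m : ℕ} (u : Fin m → ℝ) (lam1 : ℝ) {lam2 : ℝ} (hlam2 : 0 ≤ lam2) :
    ∃ t : ℝ, 0 ≤ t ∧ (∀ k, sglProx lam1 lam2 u k = t * softThresh lam1 u k) ∧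
      (1 - t) * √(∑ k, softThresh lam1 u k ^ 2) ≤ lam2 ∧ t ≤ 1 ∧
      ∑ k, (softThresh lam1 u k - sglProx lam1 lam2 u k) * sglProx lam1 lam2 u k
        = lam2 * √(∑ k, sglProx lam1 lam2 u k ^ 2) := by
  set v := softThresh lam1 u with hv
  by_cases h : lam2 < √(∑ k, v k ^ 2)
  · have hpos : 0 < √(∑ k, v k ^ 2) := hlam2.trans_lt h
    have ht : 0 ≤ 1 - lam2 / √(∑ k, v k ^ 2) := sub_nonneg.2 ((div_le_one hpos).2 h.le)
    have hw : ∀ k, sglProx lam1 lam2 u k = (1 - lam2 / √(∑ k, v k ^ 2)) * v k := fun k => by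
      rw [sglProx, if_pos h]
    refine ⟨1 - lam2 / √(∑ k, v k ^ 2), ht, hw, ?_, ?_, ?_⟩
    · rw [sub_sub_cancel, div_mul_cancel₀ _ hpos.ne']
    · linarith [div_nonneg hlam2 hpos.le]
    · simp only [hw, mul_pow]
      rw [← Finset.mul_sum, Real.sqrt_mul (sq_nonneg _), Real.sqrt_sq ht]
      have hs : √(∑ k, v k ^ 2) ^ 2 = ∑ k, v k ^ 2 :=
        Real.sq_sqrt (Finset.sum_nonneg fun _ _ => sq_nonneg _)
      generalize √(∑ k, v k ^ 2) = s at *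
      calc _ = lam2 / s * (1 - lam2 / s) * ∑ k, v k ^ 2 := by
            rw [Finset.mul_sum]; exact Finset.sum_congr rfl fun k _ => by ring
        _ = _ := by rw [← hs]; field_simp
  · have hw : ∀ k, sglProx lam1 lam2 u k = 0 := fun k => by
      rw [sglProx, if_neg h, Pi.zero_apply]
    exact ⟨0, le_rfl, by simp [hw], by simpa using h, zero_le_one, by simp [hw]⟩

/-- A point `w` with `u - w = g + h`, where `g` and `h` are subgradients at `w` of `λ₁‖·‖₁` and
`λ₂‖·‖₂`, is the strict global minimizer of the proximal objective. -/
theorem prox_lt_of_subgradients {m : ℕ} {lam1 lam2 : ℝ} {u w g h : Fin m → ℝ}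
    (hu : ∀ k, u k = w k + g k + h k) (hg : ∀ k, |g k| ≤ lam1)
    (hgw : ∀ k, g k * w k = lam1 * |w k|)
    (hh : √(∑ k, h k ^ 2) ≤ lam2) (hhw : ∑ k, h k * w k = lam2 * √(∑ k, w k ^ 2))
    {x : Fin m → ℝ} (hx : x ≠ w) :
    lam1 * (∑ k, |w k|) + lam2 * √(∑ k, w k ^ 2) + (1 / 2) * (∑ k, (w k - u k) ^ 2)
      < lam1 * (∑ k, |x k|) + lam2 * √(∑ k, x k ^ 2) + (1 / 2) * (∑ k, (x k - u k) ^ 2) := by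
  have h1 : ∑ k, g k * x k ≤ lam1 * ∑ k, |x k| := by
    rw [Finset.mul_sum]
    refine Finset.sum_le_sum fun k _ => (le_abs_self _).trans ?_
    rw [abs_mul]
    exact mul_le_mul_of_nonneg_right (hg k) (abs_nonneg _)
  have h2 : ∑ k, g k * w k = lam1 * ∑ k, |w k| := by
    rw [Finset.mul_sum]
    exact Finset.sum_congr rfl fun k _ => hgw k
  have h3 : ∑ k, h k * x k ≤ lam2 * √(∑ k, x k ^ 2) :=
    (Real.sum_mul_le_sqrt_mul_sqrt _ _ _).trans
      (mul_le_mul_of_nonneg_right hh (Real.sqrt_nonneg _))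
  have h4 : 0 < ∑ k, (x k - w k) ^ 2 := by
    obtain ⟨k, hk⟩ := Function.ne_iff.1 hx
    exact Finset.sum_pos' (fun _ _ => sq_nonneg _)
      ⟨k, Finset.mem_univ k, by have := sub_ne_zero.2 hk; positivity⟩
  have h5 : ∑ k, (x k - u k) ^ 2 = ∑ k, (w k - u k) ^ 2 + ∑ k, (x k - w k) ^ 2
      - 2 * (∑ k, g k * x k - ∑ k, g k * w k) - 2 * (∑ k, h k * x k - ∑ k, h k * w k) := by
    simp only [← Finset.sum_sub_distrib, Finset.mul_sum, ← Finset.sum_add_distrib]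
    exact Finset.sum_congr rfl fun k _ => by rw [hu k]; ring
  linarith

/-- The composed soft-threshold/group-shrinkage point is the unique global
minimizer of x ↦ λ₁‖x‖₁ + λ₂‖x‖₂ + (1/2)‖x − u‖₂², i.e. it is the proximal
point of the sparse group lasso penalty at u. -/
theorem sparse_group_lasso_prox {m : ℕ} (u : Fin m → ℝ)
    (lam1 lam2 : ℝ) (hlam1 : 0 ≤ lam1) (hlam2 : 0 ≤ lam2) :
    ∀ x : Fin m → ℝ, x ≠ sglProx lam1 lam2 u →
      lam1 * (∑ k, |sglProx lam1 lam2 u k|)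
          + lam2 * Real.sqrt (∑ k, (sglProx lam1 lam2 u k) ^ 2)
          + (1 / 2) * (∑ k, (sglProx lam1 lam2 u k - u k) ^ 2)
        < lam1 * (∑ k, |x k|) + lam2 * Real.sqrt (∑ k, (x k) ^ 2)
          + (1 / 2) * (∑ k, (x k - u k) ^ 2) := by
  intro x hx
  obtain ⟨t, ht, hw, hle, ht1, hin⟩ := sglProx_spec u lam1 hlam2
  refine prox_lt_of_subgradients (g := fun k => u k - softThresh lam1 u k)
    (h := fun k => softThresh lam1 u k - sglProx lam1 lam2 u k)
    (fun k => by ring) (abs_sub_softThresh_le hlam1 u) (fun k => ?_) ?_ hin hx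
  · rw [hw k, abs_mul, abs_of_nonneg ht, mul_left_comm,
      sub_softThresh_mul_softThresh lam1 u k]
    ring
  · have hr : ∀ k, (softThresh lam1 u k - sglProx lam1 lam2 u k) ^ 2
        = (1 - t) ^ 2 * softThresh lam1 u k ^ 2 := fun k => by rw [hw k]; ring
    simp only [hr]
    rwa [← Finset.mul_sum, Real.sqrt_mul (sq_nonneg _), Real.sqrt_sq (sub_nonneg.2 ht1)]
end

section
/- Fix t, s, m, penalty-norm exponents p, q ≥ 1, an edge set ℰ with weights w_{jj'} ≥ 0, a true coefficient tensor Θ ∈ (ℝ^{t×s})^m, a self-adjoint positive definite operator ℳ on ℝ^{t×s}, matrices Ξ^{(1)}, …, Ξ^{(m)} ∈ ℝ^{t×s}, and limits λ_{1,0}, λ_{2,0}, λ_{t,0}, λ_{g,0} ≥ 0. For each n, let 𝒳_n : ℝ^{t×s} → ℝ^n be linear with adjoint 𝒳_n*, let ε_n^{(r)} ∈ ℝ^n, set y_n^{(r)} := 𝒳_n(Θ^{(r)}) + ε_n^{(r)}, and let λ_{1,n}, λ_{2,n}, λ_{t,n}, λ_{g,n} ≥ 0. Assume, as n → ∞: (1/n)𝒳_n*𝒳_n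 → ℳ (as linear operators), (1/√n)𝒳_n*(ε_n^{(r)}) → Ξ^{(r)} for each r, and λ_{i,n}/√n → λ_{i,0} for i ∈ {1, 2, t, g}. Define F_n(ζ) := Σ_r (1/2)(‖y_n^{(r)} − 𝒳_n(Θ^{(r)} + ζ^{(r)}/√n)‖₂² − ‖y_n^{(r)} − 𝒳_n(Θ^{(r)})‖₂²) + λ_{t,n} Σ_r Σ_{i=1}^{t−1} (‖Δ_t^i Θ^{(r)} + Δ_t^i ζ^{(r)}/√n‖_p − ‖Δ_t^i Θ^{(r)}‖_p) + λ_{g,n} Σ_r Σ_{(j,j')∈ℰ} w_{jj'}(‖Δ_g^{jj'} Θ^{(r)} + Δ_g^{jj'} ζ^{(r)}/√n‖_q − ‖Δ_g^{jj'} Θ^{(r)}‖_q) + λ_{1,n} Σ_{i,j} (‖Θ_{[ij]} + ζ_{[ij]}/√n‖₁ − ‖Θ_{[ij]}‖₁) + λ_{2,n} Σ_{i,j} (‖Θ_{[ij]} + ζ_{[ij]}/√n‖₂ − ‖Θ_{[ij]}‖₂). Then for every fixed ζ ∈ (ℝ^{t×s})^m, F_n(ζ) converges as n → ∞ to F_∞(ζ)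 := Σ_r (1/2)(⟨ζ^{(r)}, ℳ(ζ^{(r)})⟩_F − 2⟨ζ^{(r)}, Ξ^{(r)}⟩_F) + λ_{t,0} Σ_r Σ_i φ_{p, Δ_t^i Θ^{(r)}}(Δ_t^i ζ^{(r)}) + λ_{g,0} Σ_r Σ_{(j,j')∈ℰ} w_{jj'} φ_{q, Δ_g^{jj'} Θ^{(r)}}(Δ_g^{jj'} ζ^{(r)}) + λ_{1,0} Σ_{i,j} φ_{1, Θ_{[ij]}}(ζ_{[ij]}) + λ_{2,0} Σ_{i,j} φ_{2, Θ_{[ij]}}(ζ_{[ij]}), where in the middle terms p, q ∈ {1, 2} and φ is as defined below. -/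
open Filter Classical

/-- Frobenius inner product on real matrices. -/
noncomputable def frob {a b : ℕ} (A B : Matrix (Fin a) (Fin b) ℝ) : ℝ :=
  ∑ i, ∑ j, A i j * B i j

/-- ℓ₁ norm on ℝ^d. -/
noncomputable def l1 {d : ℕ} (x : Fin d → ℝ) : ℝ := ∑ k, |x k|

/-- Euclidean (ℓ₂) norm on ℝ^d. -/
noncomputable def l2 {d : ℕ} (x : Fin d → ℝ) : ℝ := Real.sqrt (∑ k, (x k) ^ 2)

/-- ℓ_p norm on ℝ^d (real exponent p ≥ 1). -/
noncomputable def lpNorm {d : ℕ} (p : ℝ) (x : Fin d → ℝ) : ℝ :=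
  (∑ k, |x k| ^ p) ^ (1 / p)

/-- φ_{2,v}(h) = vᵀh/‖v‖₂ if v ≠ 0, and ‖h‖₂ if v = 0. -/
noncomputable def phi2 {d : ℕ} (v h : Fin d → ℝ) : ℝ :=
  if v = 0 then l2 h else (∑ k, v k * h k) / l2 v

/-- φ_{p,v} for p ∈ {1, 2}. -/
noncomputable def phiP {d : ℕ} (p : ℝ) (v h : Fin d → ℝ) : ℝ :=
  if p = 1 then phi1 v h else phi2 v h

/-- Index `i` of `Fin (t-1)` viewed in `Fin t`. -/
def rlo {t : ℕ} (i : Fin (t - 1)) : Fin t := ⟨i.1, by have := i.2; omega⟩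

/-- Index `i+1` of `Fin t` for `i : Fin (t-1)`. -/
def rhi {t : ℕ} (i : Fin (t - 1)) : Fin t := ⟨i.1 + 1, by have := i.2; omega⟩

/-- Temporal (row) difference Δ_t^i A = A_{i·} − A_{(i+1)·} ∈ ℝ^s. -/
noncomputable def dT {t s : ℕ} (A : Matrix (Fin t) (Fin s) ℝ) (i : Fin (t - 1)) :
    Fin s → ℝ := fun j => A (rlo i) j - A (rhi i) j

/-- Spatial (column) difference Δ_g^{jj'} A = A_{·j} − A_{·j'} ∈ ℝ^t. -/
noncomputable def dG {t s : ℕ} (A : Matrix (Fin t) (Fin s) ℝ) (e : Fin s × Fin s) :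
    Fin t → ℝ := fun i => A i e.1 - A i e.2

lemma frob_add_right {a b : ℕ} (A B C : Matrix (Fin a) (Fin b) ℝ) :
    frob A (B + C) = frob A B + frob A C := by
  simp [frob, mul_add, Finset.sum_add_distrib]

lemma frob_smul_right {a b : ℕ} (c : ℝ) (A B : Matrix (Fin a) (Fin b) ℝ) :
    frob A (c • B) = c * frob A B := by
  simp [frob, Finset.mul_sum, mul_left_comm]

lemma frob_comm {a b : ℕ} (A B : Matrix (Fin a) (Fin b) ℝ) : frob A B = frob B A := by
  simp [frob, mul_comm]

lemma frob_sum_right {ι : Type*} {a b : ℕ} (S : Finset ι) (A : Matrix (Fin a) (Fin b) ℝ)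
    (B : ι → Matrix (Fin a) (Fin b) ℝ) : frob A (∑ k ∈ S, B k) = ∑ k ∈ S, frob A (B k) := by
  induction S using Finset.induction_on with
  | empty => simp [frob]
  | insert k S hk ih => rw [Finset.sum_insert hk, Finset.sum_insert hk, frob_add_right, ih]

lemma continuous_frob_right {a b : ℕ} (A : Matrix (Fin a) (Fin b) ℝ) :
    Continuous (fun B => frob A B) := by
  unfold frob
  fun_prop

lemma lpNorm_one {d : ℕ} (x : Fin d → ℝ) : lpNorm 1 x = l1 x := by
  simp [lpNorm, l1]

lemma lpNorm_two {d : ℕ} (x : Fin d → ℝ) : lpNorm 2 x = l2 x := by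
  simp [lpNorm, l2, Real.sqrt_eq_rpow]

lemma hasDerivWithinAt_abs_line (a b : ℝ) :
    HasDerivWithinAt (fun τ : ℝ => |a + τ * b|) (if a = 0 then |b| else sgn a * b)
      (Set.Ioi 0) 0 := by
  have hline : HasDerivAt (fun τ : ℝ => a + τ * b) b 0 := by
    simpa using ((hasDerivAt_id (0 : ℝ)).mul_const b).const_add a
  rcases lt_trichotomy a 0 with ha | rfl | ha
  · have h := (hasDerivAt_abs_neg (x := a + 0 * b) (by simpa using ha)).comp (0 : ℝ) hline
    simpa [Function.comp_def, sgn, ha.ne, ha, ha.not_gt] using h.hasDerivWithinAt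
  · have h : HasDerivWithinAt (fun τ : ℝ => τ * |b|) |b| (Set.Ioi 0) 0 := by
      simpa using ((hasDerivAt_id (0 : ℝ)).mul_const |b|).hasDerivWithinAt
    simp only [if_true]
    refine h.congr (fun τ hτ => ?_) (by simp)
    rw [zero_add, abs_mul, abs_of_pos hτ]
  · have h := (hasDerivAt_abs_pos (x := a + 0 * b) (by simpa using ha)).comp (0 : ℝ) hline
    simpa [Function.comp_def, sgn, ha.ne', ha] using h.hasDerivWithinAt

lemma hasDerivWithinAt_l1_line {d : ℕ} (v h : Fin d → ℝ) :
    HasDerivWithinAt (fun τ : ℝ => l1 (fun k => v k + τ * h k)) (phi1 v h) (Set.Ioi 0) 0 := by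
  have hphi : phi1 v h = ∑ k, if v k = 0 then |h k| else sgn (v k) * h k := by
    rw [phi1, Finset.sum_ite, add_comm]
  rw [hphi]
  exact HasDerivWithinAt.fun_sum fun k _ => hasDerivWithinAt_abs_line (v k) (h k)

lemma l2_smul_of_nonneg {d : ℕ} {τ : ℝ} (hτ : 0 ≤ τ) (h : Fin d → ℝ) :
    l2 (fun k => τ * h k) = τ * l2 h := by
  simp only [l2, mul_pow, ← Finset.mul_sum]
  rw [Real.sqrt_mul (sq_nonneg τ), Real.sqrt_sq hτ]

lemma hasDerivWithinAt_l2_line {d : ℕ} (v h : Fin d → ℝ) :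
    HasDerivWithinAt (fun τ : ℝ => l2 (fun k => v k + τ * h k)) (phi2 v h) (Set.Ioi 0) 0 := by
  by_cases hv : v = 0
  · subst hv
    have hlin : HasDerivWithinAt (fun τ : ℝ => τ * l2 h) (l2 h) (Set.Ioi 0) 0 := by
      simpa using ((hasDerivAt_id (0 : ℝ)).mul_const (l2 h)).hasDerivWithinAt
    simp only [phi2, if_true, Pi.zero_apply, zero_add]
    exact hlin.congr (fun τ hτ => l2_smul_of_nonneg (le_of_lt hτ) h)
      (l2_smul_of_nonneg le_rfl h)
  · have hne : ∑ k, (v k) ^ 2 ≠ 0 := by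
      intro h0
      refine hv (funext fun k => ?_)
      simpa using (Finset.sum_eq_zero_iff_of_nonneg fun k _ => sq_nonneg (v k)).1 h0 k
        (Finset.mem_univ k)
    have hsum : HasDerivAt (fun τ : ℝ => ∑ k, (v k + τ * h k) ^ 2) (∑ k, 2 * v k * h k) 0 := by
      refine HasDerivAt.fun_sum fun k _ => ?_
      have hk := (((hasDerivAt_id (0 : ℝ)).mul_const (h k)).const_add (v k)).fun_pow 2
      simpa using hk
    have hsqrt := hsum.sqrt (by simpa using hne)
    have hval : phi2 v h = (∑ k, 2 * v k * h k) / (2 * √(∑ k, (v k + 0 * h k) ^ 2)) := by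
      simp only [phi2, hv, if_false, l2, zero_mul, add_zero, mul_assoc, ← Finset.mul_sum]
      rw [mul_div_mul_left _ _ two_ne_zero]
    rw [hval]
    exact hsqrt.hasDerivWithinAt

lemma hasDerivWithinAt_lpNorm_line {d : ℕ} {p : ℝ} (hp : p = 1 ∨ p = 2) (v h : Fin d → ℝ) :
    HasDerivWithinAt (fun τ : ℝ => lpNorm p (fun k => v k + τ * h k)) (phiP p v h)
      (Set.Ioi 0) 0 := by
  rcases hp with rfl | rfl
  · simpa only [lpNorm_one, phiP, if_true] using hasDerivWithinAt_l1_line v h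
  · have h21 : (2 : ℝ) ≠ 1 := by norm_num
    simpa only [lpNorm_two, phiP, if_neg h21] using hasDerivWithinAt_l2_line v h

/-- If `N` has one-sided directional derivative `D` at `v` along `h`, its increments along
`h / √n`, rescaled by `√n`, converge to `D`. -/
lemma tendsto_sqrt_mul_sub {d : ℕ} {N : (Fin d → ℝ) → ℝ} {v h : Fin d → ℝ} {D : ℝ}
    (hN : HasDerivWithinAt (fun τ : ℝ => N (fun k => v k + τ * h k)) D (Set.Ioi 0) 0) :
    Tendsto (fun n : ℕ => √n * (N (fun k => v k + h k / √n) - N v)) atTop (nhds D) := by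
  have hslope := (hasDerivWithinAt_iff_tendsto_slope' (by simp)).1 hN
  have hτ : Tendsto (fun n : ℕ => (√(n : ℝ))⁻¹) atTop (nhdsWithin 0 (Set.Ioi 0)) :=
    tendsto_inv_atTop_nhdsGT_zero.comp (Real.tendsto_sqrt_atTop.comp tendsto_natCast_atTop_atTop)
  refine (hslope.comp hτ).congr fun n => ?_
  simp [slope_def_field, div_eq_inv_mul]

lemma tendsto_mul_of_div_sqrt {c : ℕ → ℝ} {c₀ L : ℝ} {u : ℕ → ℝ}
    (hc : Tendsto (fun n : ℕ => c n / √n) atTop (nhds c₀))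
    (hu : Tendsto (fun n : ℕ => √n * u n) atTop (nhds L)) :
    Tendsto (fun n => c n * u n) atTop (nhds (c₀ * L)) := by
  refine (hc.mul hu).congr' ?_
  filter_upwards [eventually_gt_atTop 0] with n hn
  have : √(n : ℝ) ≠ 0 := by positivity
  field_simp

/-- The recentered squared loss, written through the adjoint images of the design and noise. -/
lemma sum_sq_sub_sum_sq {a b n : ℕ} (X : Fin n → Matrix (Fin a) (Fin b) ℝ) (e y : Fin n → ℝ)
    (Θ ζ : Matrix (Fin a) (Fin b) ℝ) (hy : ∀ k, y k = frob (X k) Θ + e k) :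
    (∑ k, (y k - frob (X k) (Θ + (1 / √(n : ℝ)) • ζ)) ^ 2) - ∑ k, (y k - frob (X k) Θ) ^ 2
      = frob ζ ((1 / (n : ℝ)) • ∑ k, frob (X k) ζ • X k)
        - 2 * frob ζ ((1 / √(n : ℝ)) • ∑ k, e k • X k) := by
  have hn : (1 / (n : ℝ)) = (1 / √(n : ℝ)) ^ 2 := by
    rw [div_pow, Real.sq_sqrt n.cast_nonneg, one_pow]
  simp only [frob_smul_right, frob_sum_right, hn, Finset.mul_sum, ← Finset.sum_sub_distrib]
  refine Finset.sum_congr rfl fun k _ => ?_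
  rw [hy, frob_add_right, frob_smul_right, frob_comm ζ (X k)]
  ring

/-- Deterministic pointwise convergence of the recentered MultiGGFL objectives
F_n to the limit objective F_∞. -/
theorem recentered_objective_pointwise_limit
    (t s m : ℕ) (ht : 0 < t) (hs : 0 < s) (hm : 0 < m)
    (p q : ℝ) (hp : p = 1 ∨ p = 2) (hq : q = 1 ∨ q = 2)
    (E : Finset (Fin s × Fin s)) (w : Fin s × Fin s → ℝ) (hw : ∀ e ∈ E, 0 ≤ w e)
    (Θ : Fin m → Matrix (Fin t) (Fin s) ℝ)
    (M : Matrix (Fin t) (Fin s) ℝ →ₗ[ℝ] Matrix (Fin t) (Fin s) ℝ)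
    (hMsa : ∀ A B : Matrix (Fin t) (Fin s) ℝ, frob A (M B) = frob (M A) B)
    (hMpd : ∀ A : Matrix (Fin t) (Fin s) ℝ, A ≠ 0 → 0 < frob A (M A))
    (Ξ : Fin m → Matrix (Fin t) (Fin s) ℝ)
    (lam10 lam20 lamt0 lamg0 : ℝ)
    (hlam10 : 0 ≤ lam10) (hlam20 : 0 ≤ lam20) (hlamt0 : 0 ≤ lamt0) (hlamg0 : 0 ≤ lamg0)
    (X : (n : ℕ) → Fin n → Matrix (Fin t) (Fin s) ℝ)
    (ε : (n : ℕ) → Fin m → Fin n → ℝ)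
    (y : (n : ℕ) → Fin m → Fin n → ℝ)
    (hy : ∀ n r k, y n r k = frob (X n k) (Θ r) + ε n r k)
    (lam1 lam2 lamt lamg : ℕ → ℝ)
    (hlam1 : ∀ n, 0 ≤ lam1 n) (hlam2 : ∀ n, 0 ≤ lam2 n)
    (hlamt : ∀ n, 0 ≤ lamt n) (hlamg : ∀ n, 0 ≤ lamg n)
    (hM : ∀ A : Matrix (Fin t) (Fin s) ℝ,
      Tendsto (fun n : ℕ => (1 / (n : ℝ)) • ∑ k, frob (X n k) A • X n k)
        atTop (nhds (M A)))
    (hXi : ∀ r : Fin m,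
      Tendsto (fun n : ℕ => (1 / Real.sqrt n) • ∑ k, ε n r k • X n k)
        atTop (nhds (Ξ r)))
    (hc1 : Tendsto (fun n : ℕ => lam1 n / Real.sqrt n) atTop (nhds lam10))
    (hc2 : Tendsto (fun n : ℕ => lam2 n / Real.sqrt n) atTop (nhds lam20))
    (hct : Tendsto (fun n : ℕ => lamt n / Real.sqrt n) atTop (nhds lamt0))
    (hcg : Tendsto (fun n : ℕ => lamg n / Real.sqrt n) atTop (nhds lamg0)) :
    ∀ ζ : Fin m → Matrix (Fin t) (Fin s) ℝ,
      Tendsto (fun n : ℕ =>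
        (∑ r, (1 / 2) *
          ((∑ k, (y n r k - frob (X n k) (Θ r + (1 / Real.sqrt n) • ζ r)) ^ 2)
            - ∑ k, (y n r k - frob (X n k) (Θ r)) ^ 2))
        + lamt n * ∑ r, ∑ i : Fin (t - 1),
            (lpNorm p (fun j => dT (Θ r) i j + dT (ζ r) i j / Real.sqrt n)
              - lpNorm p (dT (Θ r) i))
        + lamg n * ∑ r, ∑ e ∈ E, w e *
            (lpNorm q (fun i => dG (Θ r) e i + dG (ζ r) e i / Real.sqrt n)
              - lpNorm q (dG (Θ r) e))
        + lam1 n * ∑ i : Fin t, ∑ j : Fin s,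
            (l1 (fun r' => Θ r' i j + ζ r' i j / Real.sqrt n) - l1 (fun r' => Θ r' i j))
        + lam2 n * ∑ i : Fin t, ∑ j : Fin s,
            (l2 (fun r' => Θ r' i j + ζ r' i j / Real.sqrt n) - l2 (fun r' => Θ r' i j)))
      atTop
      (nhds (
        (∑ r, (1 / 2) * (frob (ζ r) (M (ζ r)) - 2 * frob (ζ r) (Ξ r)))
        + lamt0 * ∑ r, ∑ i : Fin (t - 1), phiP p (dT (Θ r) i) (dT (ζ r) i)
        + lamg0 * ∑ r, ∑ e ∈ E, w e * phiP q (dG (Θ r) e) (dG (ζ r) e)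
        + lam10 * ∑ i : Fin t, ∑ j : Fin s,
            phi1 (fun r' => Θ r' i j) (fun r' => ζ r' i j)
        + lam20 * ∑ i : Fin t, ∑ j : Fin s,
            phi2 (fun r' => Θ r' i j) (fun r' => ζ r' i j))) := by
  intro ζ
  have hloss : Tendsto (fun n : ℕ => ∑ r, (1 / 2) *
      ((∑ k, (y n r k - frob (X n k) (Θ r + (1 / Real.sqrt n) • ζ r)) ^ 2)
        - ∑ k, (y n r k - frob (X n k) (Θ r)) ^ 2)) atTop
      (nhds (∑ r, (1 / 2) * (frob (ζ r) (M (ζ r)) - 2 * frob (ζ r) (Ξ r)))) := by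
    refine tendsto_finsetSum _ fun r _ => Tendsto.const_mul _ ?_
    simp only [fun n => sum_sq_sub_sum_sq (X n) (ε n r) (y n r) (Θ r) (ζ r) (hy n r)]
    exact (((continuous_frob_right (ζ r)).tendsto _).comp (hM (ζ r))).sub
      ((((continuous_frob_right (ζ r)).tendsto _).comp (hXi r)).const_mul 2)
  refine (((hloss.add (tendsto_mul_of_div_sqrt hct ?_)).add
    (tendsto_mul_of_div_sqrt hcg ?_)).add (tendsto_mul_of_div_sqrt hc1 ?_)).add
    (tendsto_mul_of_div_sqrt hc2 ?_)
  · simp only [Finset.mul_sum]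
    exact tendsto_finsetSum _ fun r _ => tendsto_finsetSum _ fun i _ =>
      tendsto_sqrt_mul_sub (hasDerivWithinAt_lpNorm_line hp (dT (Θ r) i) (dT (ζ r) i))
  · simp only [Finset.mul_sum, mul_left_comm _ (w _)]
    exact tendsto_finsetSum _ fun r _ => tendsto_finsetSum _ fun e _ =>
      (tendsto_sqrt_mul_sub
        (hasDerivWithinAt_lpNorm_line hq (dG (Θ r) e) (dG (ζ r) e))).const_mul (w e)
  · simp only [Finset.mul_sum]
    exact tendsto_finsetSum _ fun i _ => tendsto_finsetSum _ fun j _ =>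
      tendsto_sqrt_mul_sub (hasDerivWithinAt_l1_line (fun r => Θ r i j) fun r => ζ r i j)
  · simp only [Finset.mul_sum]
    exact tendsto_finsetSum _ fun i _ => tendsto_finsetSum _ fun j _ =>
      tendsto_sqrt_mul_sub (hasDerivWithinAt_l2_line (fun r => Θ r i j) fun r => ζ r i j)
end
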